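/- arXiv:2503.22292 — 7 statements merged into one kernel-verified Lean document; each statement's English description precedes it below -/
import Mathlib

section
/- Fix positive reals λ, μ, γ, r and a positive integer d with λ/(rμ) < 1. Then among all equilibrium states (π, ε) of the SLQ(d) mean-field equations with ∑_{i≥1} πᵢ < ∞, there exists exactly one. Moreover this unique equilibrium state satisfies ε = λ/(rμ), π₁ = 1 − (1 − λ/(r(γ(1−ε) + με)))^{1/d}, and for every i ≥ 1, π_{i+1} = 1 − (1 − (λ/(r(γ(1−ε) + με))) πᵢ)^{1/d}. -/
/-- An equilibrium state of the SLQ(d) mean-field equations: a pair `(pi, eps)` where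
`pi` is a `[0,1]`-valued sequence with `pi 0 = 1`, `eps ∈ [0,1]`, satisfying the flow
equations for all `i ≥ 1` and the server equation. -/
def SLQEquilibrium (lam mu gam r : ℝ) (d : ℕ) (pi : ℕ → ℝ) (eps : ℝ) : Prop :=
  pi 0 = 1 ∧ (∀ i, pi i ∈ Set.Icc (0:ℝ) 1) ∧ eps ∈ Set.Icc (0:ℝ) 1 ∧
  (∀ i, 1 ≤ i → lam * (pi (i-1) - pi i)
      = r * (gam * (1 - eps) + mu * eps) * ((1 - pi (i+1))^d - (1 - pi i)^d)) ∧
  gam * (1 - eps) * (1 - (1 - pi 1)^d) = mu * eps * (1 - pi 1)^d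

/-- The rate `r * (gam * (1 - eps) + mu * eps)` in the flow equations. -/
def slqRate (mu gam r eps : ℝ) : ℝ := r * (gam * (1 - eps) + mu * eps)

/-- The sequence started at `1` and generated by `p ↦ 1 - (1 - rho * p) ^ (1 / d)`. -/
noncomputable def slqSeq (rho : ℝ) (d : ℕ) : ℕ → ℝ
  | 0 => 1
  | i + 1 => 1 - (1 - rho * slqSeq rho d i) ^ ((1 : ℝ) / d)

theorem slqRate_pos {mu gam r eps : ℝ} (hmu : 0 < mu) (hgam : 0 < gam) (hr : 0 < r)
    (heps : eps ∈ Set.Icc (0 : ℝ) 1) : 0 < slqRate mu gam r eps := by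
  obtain ⟨h0, h1⟩ := heps
  refine mul_pos hr ?_
  rcases h0.eq_or_lt with rfl | h
  · simpa using hgam
  · exact add_pos_of_nonneg_of_pos (mul_nonneg hgam.le (sub_nonneg.2 h1)) (mul_pos hmu h)

theorem slqSeq_mem_Icc {rho : ℝ} (h0 : 0 ≤ rho) (h1 : rho ≤ 1) (d : ℕ) (i : ℕ) :
    slqSeq rho d i ∈ Set.Icc (0 : ℝ) 1 := by
  induction i with
  | zero => simp [slqSeq]
  | succ i ih =>
    have hnonneg : 0 ≤ 1 - rho * slqSeq rho d i := by nlinarith [ih.1, ih.2]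
    have hle : 1 - rho * slqSeq rho d i ≤ 1 := by nlinarith [ih.1, ih.2]
    have hexp : (0 : ℝ) ≤ 1 / d := by positivity
    have := Real.rpow_nonneg hnonneg ((1 : ℝ) / d)
    have := Real.rpow_le_one hnonneg hle hexp
    simp only [slqSeq, Set.mem_Icc]
    constructor <;> linarith

theorem one_sub_slqSeq_succ_pow {rho : ℝ} (h0 : 0 ≤ rho) (h1 : rho ≤ 1) {d : ℕ} (hd : 0 < d)
    (i : ℕ) : (1 - slqSeq rho d (i + 1)) ^ d = 1 - rho * slqSeq rho d i := by
  have h := slqSeq_mem_Icc h0 h1 d i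
  have hnonneg : 0 ≤ 1 - rho * slqSeq rho d i := by nlinarith [h.1, h.2]
  simp only [slqSeq, sub_sub_cancel, one_div]
  exact Real.rpow_inv_natCast_pow hnonneg hd.ne'

theorem slqSeq_succ_le {rho : ℝ} (h0 : 0 ≤ rho) (h1 : rho ≤ 1) {d : ℕ} (hd : 0 < d) (i : ℕ) :
    slqSeq rho d (i + 1) ≤ rho * slqSeq rho d i := by
  have h := slqSeq_mem_Icc h0 h1 d (i + 1)
  have hpow := pow_le_of_le_one (sub_nonneg.2 h.2) (sub_le_self 1 h.1) hd.ne'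
  rw [one_sub_slqSeq_succ_pow h0 h1 hd] at hpow
  linarith

theorem summable_slqSeq {rho : ℝ} (h0 : 0 ≤ rho) (h1 : rho < 1) {d : ℕ} (hd : 0 < d) :
    Summable (slqSeq rho d) := by
  refine Summable.of_nonneg_of_le (fun i => (slqSeq_mem_Icc h0 h1.le d i).1) (fun i => ?_)
    (summable_geometric_of_lt_one h0 h1)
  induction i with
  | zero => simp [slqSeq]
  | succ i ih =>
    rw [pow_succ']
    exact (slqSeq_succ_le h0 h1.le hd i).trans (mul_le_mul_of_nonneg_left ih h0)

theorem slqRate_div_eq {lam mu gam r : ℝ} (hmu : 0 < mu) (hr : 0 < r) :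
    slqRate mu gam r (lam / (r * mu)) = r * gam * (1 - lam / (r * mu)) + lam := by
  unfold slqRate
  field_simp

theorem slqEquilibrium_slqSeq {lam mu gam r : ℝ} {d : ℕ} (hlam : 0 < lam) (hmu : 0 < mu)
    (hgam : 0 < gam) (hr : 0 < r) (hd : 0 < d) (hload : lam / (r * mu) < 1) :
    SLQEquilibrium lam mu gam r d
        (slqSeq (lam / slqRate mu gam r (lam / (r * mu))) d) (lam / (r * mu)) ∧
      Summable (slqSeq (lam / slqRate mu gam r (lam / (r * mu))) d) := by
  have heps : lam / (r * mu) ∈ Set.Icc (0 : ℝ) 1 := ⟨by positivity, hload.le⟩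
  have hC : 0 < slqRate mu gam r (lam / (r * mu)) := slqRate_pos hmu hgam hr heps
  have hlt : lam < slqRate mu gam r (lam / (r * mu)) := by
    rw [slqRate_div_eq hmu hr]
    have := mul_pos (mul_pos hr hgam) (sub_pos.2 hload)
    linarith
  have hmueps : r * (mu * (lam / (r * mu))) = lam := by field_simp
  have hCdef : slqRate mu gam r (lam / (r * mu)) =
    r * (gam * (1 - lam / (r * mu)) + mu * (lam / (r * mu))) := rfl
  generalize lam / (r * mu) = eps at *
  generalize slqRate mu gam r eps = C at *
  have h0 : 0 ≤ lam / C := by positivity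
  have h1 : lam / C < 1 := (div_lt_one hC).2 hlt
  have hmul : C * (lam / C) = lam := mul_div_cancel₀ lam hC.ne'
  generalize lam / C = rho at *
  refine ⟨⟨rfl, slqSeq_mem_Icc h0 h1.le d, heps, ?_, ?_⟩, summable_slqSeq h0 h1 hd⟩
  · intro i hi
    obtain ⟨j, rfl⟩ := Nat.exists_eq_add_of_le' hi
    rw [← hCdef, one_sub_slqSeq_succ_pow h0 h1.le hd, one_sub_slqSeq_succ_pow h0 h1.le hd,
      Nat.add_sub_cancel]
    linear_combination (slqSeq rho d (j + 1) - slqSeq rho d j) * hmul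
  · rw [one_sub_slqSeq_succ_pow h0 h1.le hd 0]
    simp only [slqSeq, mul_one]
    apply mul_left_cancel₀ hr.ne'
    rw [hCdef] at hmul
    linear_combination hmul - hmueps

/-- Summing the flow equations shows that `lam * pi i + C * (1 - pi (i + 1)) ^ d` does not depend
on `i`, and summability identifies its value as `C = slqRate mu gam r eps`. -/
theorem SLQEquilibrium.rate_mul_pow {lam mu gam r : ℝ} {d : ℕ} {pi : ℕ → ℝ} {eps : ℝ}
    (h : SLQEquilibrium lam mu gam r d pi eps) (hs : Summable (fun i => pi (i + 1))) (i : ℕ) :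
    lam * pi i + slqRate mu gam r eps * (1 - pi (i + 1)) ^ d = slqRate mu gam r eps := by
  obtain ⟨-, -, -, hflow, -⟩ := h
  have hconst : ∀ j, lam * pi j + slqRate mu gam r eps * (1 - pi (j + 1)) ^ d =
      lam * pi 0 + slqRate mu gam r eps * (1 - pi 1) ^ d := by
    intro j
    induction j with
    | zero => rfl
    | succ j ih =>
      have := hflow (j + 1) (Nat.le_add_left 1 j)
      rw [Nat.add_sub_cancel] at this
      rw [← ih, slqRate]
      linear_combination -this
  have hlim1 := hs.tendsto_atTop_zero
  have hlim0 := (Filter.tendsto_add_atTop_iff_nat 1).1 hlim1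
  have hlim := (hlim0.const_mul lam).add
    (((hlim1.const_sub 1).pow d).const_mul (slqRate mu gam r eps))
  simp only [hconst, mul_zero, sub_zero, one_pow, mul_one, zero_add] at hlim
  rw [hconst i]
  exact tendsto_nhds_unique tendsto_const_nhds hlim

theorem SLQEquilibrium.eps_eq {lam mu gam r : ℝ} {d : ℕ} {pi : ℕ → ℝ} {eps : ℝ}
    (hmu : 0 < mu) (hr : 0 < r) (h : SLQEquilibrium lam mu gam r d pi eps)
    (hs : Summable (fun i => pi (i + 1))) : eps = lam / (r * mu) := by
  have hrate := h.rate_mul_pow hs 0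
  obtain ⟨hzero, -, -, -, hserver⟩ := h
  rw [hzero, slqRate, zero_add] at hrate
  rw [eq_div_iff (mul_pos hr hmu).ne']
  linear_combination -r * hserver - hrate

theorem SLQEquilibrium.succ_eq {lam mu gam r : ℝ} {d : ℕ} {pi : ℕ → ℝ} {eps : ℝ}
    (hmu : 0 < mu) (hgam : 0 < gam) (hr : 0 < r) (hd : 0 < d)
    (h : SLQEquilibrium lam mu gam r d pi eps) (hs : Summable (fun i => pi (i + 1))) (i : ℕ) :
    pi (i + 1) = 1 - (1 - lam / slqRate mu gam r eps * pi i) ^ ((1 : ℝ) / d) := by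
  have hC := slqRate_pos hmu hgam hr h.2.2.1
  have hpow : 1 - lam / slqRate mu gam r eps * pi i = (1 - pi (i + 1)) ^ d := by
    have := h.rate_mul_pow hs i
    field_simp
    linear_combination -this
  rw [hpow, one_div, Real.pow_rpow_inv_natCast (sub_nonneg.2 (h.2.1 (i + 1)).2) hd.ne',
    sub_sub_cancel]

theorem SLQEquilibrium.eq_slqSeq {lam mu gam r : ℝ} {d : ℕ} {pi : ℕ → ℝ} {eps : ℝ}
    (hmu : 0 < mu) (hgam : 0 < gam) (hr : 0 < r) (hd : 0 < d)
    (h : SLQEquilibrium lam mu gam r d pi eps) (hs : Summable (fun i => pi (i + 1))) :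
    pi = slqSeq (lam / slqRate mu gam r eps) d := by
  funext i
  induction i with
  | zero => exact h.1
  | succ i ih => rw [h.succ_eq hmu hgam hr hd hs i, ih, slqSeq]


theorem slq_unique_equilibrium
    (lam mu gam r : ℝ) (d : ℕ)
    (hlam : 0 < lam) (hmu : 0 < mu) (hgam : 0 < gam) (hr : 0 < r) (hd : 0 < d)
    (hload : lam / (r * mu) < 1) :
    (∃! pe : (ℕ → ℝ) × ℝ,
        SLQEquilibrium lam mu gam r d pe.1 pe.2 ∧ Summable (fun i => pe.1 (i+1))) ∧
    (∀ pi : ℕ → ℝ, ∀ eps : ℝ,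
        SLQEquilibrium lam mu gam r d pi eps → Summable (fun i => pi (i+1)) →
        eps = lam / (r * mu) ∧
        pi 1 = 1 - (1 - lam / (r * (gam * (1 - eps) + mu * eps))) ^ ((1:ℝ)/d) ∧
        (∀ i, 1 ≤ i →
          pi (i+1)
            = 1 - (1 - lam / (r * (gam * (1 - eps) + mu * eps)) * pi i) ^ ((1:ℝ)/d))) := by
  refine ⟨?_, fun pi eps h hs => ⟨h.eps_eq hmu hr hs, ?_, fun i _ => h.succ_eq hmu hgam hr hd hs i⟩⟩
  · obtain ⟨heq, hsum⟩ := slqEquilibrium_slqSeq hlam hmu hgam hr hd hload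
    refine ⟨(_, _), ⟨heq, (summable_nat_add_iff 1).2 hsum⟩, ?_⟩
    rintro ⟨pi, eps⟩ ⟨h, hs⟩
    obtain rfl : eps = lam / (r * mu) := h.eps_eq hmu hr hs
    exact Prod.ext (h.eq_slqSeq hmu hgam hr hd hs) rfl
  · simpa only [h.1, mul_one, slqRate, zero_add] using h.succ_eq hmu hgam hr hd hs 0
end

section
/- Fix positive reals λ, μ, γ, r and a positive integer d. Suppose (π, ε) satisfies the flow equations with π₀ = 1, every πᵢ ∈ [0,1], ε ∈ [0,1], and πⱼ → 0 as j → ∞. Then r(γ(1−ε) + με)(1 − (1 − π₁)^d) = λ, and consequently π₁ = 1 − (1 − λ/(r(γ(1−ε) + με)))^{1/d}. -/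
open Filter

theorem slq_pi_one
    (lam mu gam r : ℝ) (d : ℕ)
    (hlam : 0 < lam) (hmu : 0 < mu) (hgam : 0 < gam) (hr : 0 < r) (hd : 0 < d)
    (pi : ℕ → ℝ) (eps : ℝ)
    (hpi0 : pi 0 = 1) (hpi : ∀ i, pi i ∈ Set.Icc (0:ℝ) 1)
    (heps : eps ∈ Set.Icc (0:ℝ) 1)
    (hflow : ∀ i, 1 ≤ i → lam * (pi (i-1) - pi i)
        = r * (gam * (1 - eps) + mu * eps) * ((1 - pi (i+1))^d - (1 - pi i)^d))
    (hlim : Tendsto pi atTop (nhds 0)) :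
    r * (gam * (1 - eps) + mu * eps) * (1 - (1 - pi 1)^d) = lam ∧
    pi 1 = 1 - (1 - lam / (r * (gam * (1 - eps) + mu * eps))) ^ ((1:ℝ)/d) := by
  set c := r * (gam * (1 - eps) + mu * eps)
  have hconst : ∀ i, lam * pi i + c * (1 - pi (i + 1)) ^ d = lam + c * (1 - pi 1) ^ d := by
    intro i
    induction i with
    | zero => simp [hpi0]
    | succ k ih =>
      have h := hflow (k + 1) (Nat.le_add_left 1 k)
      rw [Nat.add_sub_cancel] at h
      linarith
  have hlim' : Tendsto (fun i => lam * pi i + c * (1 - pi (i + 1)) ^ d) atTop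
      (nhds (lam * 0 + c * (1 - 0) ^ d)) :=
    (hlim.const_mul lam).add
      (((((tendsto_add_atTop_iff_nat 1).2 hlim).const_sub 1).pow d).const_mul c)
  simp only [hconst] at hlim'
  have hbalance := tendsto_nhds_unique hlim' tendsto_const_nhds
  simp only [mul_zero, sub_zero, one_pow, mul_one, zero_add] at hbalance
  have hmain : c * (1 - (1 - pi 1) ^ d) = lam := by linarith
  refine ⟨hmain, ?_⟩
  have hc : c ≠ 0 := by
    rintro hc
    rw [hc, zero_mul] at hmain
    exact hlam.ne hmain
  have hpow : 1 - lam / c = (1 - pi 1) ^ d := by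
    rw [← hmain, mul_div_cancel_left₀ _ hc, sub_sub_cancel]
  rw [hpow, one_div, Real.pow_rpow_inv_natCast (sub_nonneg.2 (hpi 1).2) hd.ne', sub_sub_cancel]
end

section
/- Let ρ ∈ (0,1) be a real number and d a positive integer. Define π₀ = 1 and π_{i+1} = 1 − (1 − ρπᵢ)^{1/d} for i ≥ 0. Then the series ∑_{i≥1} πᵢ converges and its sum is at most ρ/(1 − ρ); in particular πᵢ → 0 as i → ∞. -/
open Filter

/-- On the unit interval, `t ↦ 1 - (1 - t) ^ s` with `s ∈ [0, 1]` takes values in `[0, t]`. -/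
theorem one_sub_one_sub_rpow_mem_Icc {t s : ℝ} (ht : t ∈ Set.Ico (0:ℝ) 1)
    (hs : s ∈ Set.Icc (0:ℝ) 1) : 1 - (1 - t) ^ s ∈ Set.Icc 0 t := by
  have hpos : 0 < 1 - t := by linarith [ht.2]
  have hle : 1 - t ≤ 1 := by linarith [ht.1]
  have hupper := Real.rpow_le_one hpos.le hle hs.1
  have hlower := Real.rpow_le_rpow_of_exponent_ge hpos hle hs.2
  rw [Real.rpow_one] at hlower
  constructor <;> linarith

theorem slq_seq_summable
    (ρ : ℝ) (hρ : ρ ∈ Set.Ioo (0:ℝ) 1) (d : ℕ) (hd : 0 < d)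
    (pi : ℕ → ℝ) (hpi0 : pi 0 = 1)
    (hrec : ∀ i, pi (i+1) = 1 - (1 - ρ * pi i) ^ ((1:ℝ)/d)) :
    Summable (fun i => pi (i+1)) ∧
    (∑' i : ℕ, pi (i+1)) ≤ ρ / (1 - ρ) ∧
    Tendsto pi atTop (nhds 0) := by
  obtain ⟨hρ0, hρ1⟩ := hρ
  have hs : (1:ℝ) / d ∈ Set.Icc (0:ℝ) 1 := by
    have hd1 : (1:ℝ) ≤ d := by exact_mod_cast hd
    exact ⟨by positivity, div_le_one_of_le₀ hd1 (by positivity)⟩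
  have hbound : ∀ i, 0 ≤ pi i ∧ pi i ≤ ρ ^ i := by
    intro i
    induction i with
    | zero => simp [hpi0]
    | succ i ih =>
      have hmul : ρ * pi i ≤ ρ ^ (i + 1) := by
        rw [pow_succ']
        exact mul_le_mul_of_nonneg_left ih.2 hρ0.le
      have hlt : ρ ^ (i + 1) < 1 := pow_lt_one₀ hρ0.le hρ1 i.succ_ne_zero
      have hmem := one_sub_one_sub_rpow_mem_Icc
        ⟨mul_nonneg hρ0.le ih.1, hmul.trans_lt hlt⟩ hs
      rw [hrec i]
      exact ⟨hmem.1, hmem.2.trans hmul⟩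
  have hgeom : HasSum (fun i : ℕ => ρ ^ (i + 1)) (ρ / (1 - ρ)) := by
    simpa only [pow_succ', div_eq_mul_inv] using
      (hasSum_geometric_of_lt_one hρ0.le hρ1).mul_left ρ
  have hsum : Summable (fun i => pi (i + 1)) :=
    hgeom.summable.of_nonneg_of_le (fun i => (hbound (i + 1)).1) fun i => (hbound (i + 1)).2
  refine ⟨hsum, ?_, ((summable_nat_add_iff 1).mp hsum).tendsto_atTop_zero⟩
  rw [← hgeom.tsum_eq]
  exact hsum.tsum_le_tsum (fun i => (hbound (i + 1)).2) hgeom.summable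
end

section
/- Fix positive reals λ, μ, γ, r and a positive integer d with λ/(rμ) < 1. Set ε = λ/(rμ), ρ = λ/(r(γ(1−ε) + με)), and define π₀ = 1 and π_{i+1} = 1 − (1 − ρπᵢ)^{1/d} for i ≥ 0. Then the pair (π, ε) is an equilibrium state: it satisfies the flow equations λ(π_{i−1} − πᵢ) = r(γ(1−ε) + με)((1−π_{i+1})^d − (1−πᵢ)^d) for all i ≥ 1 and the server equation γ(1−ε)(1 − (1−π₁)^d) = με(1−π₁)^d. -/
theorem slq_recursion_is_equilibrium
    (lam mu gam r : ℝ) (d : ℕ)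
    (hlam : 0 < lam) (hmu : 0 < mu) (hgam : 0 < gam) (hr : 0 < r) (hd : 0 < d)
    (hload : lam / (r * mu) < 1)
    (eps ρ : ℝ)
    (heps : eps = lam / (r * mu))
    (hρ : ρ = lam / (r * (gam * (1 - eps) + mu * eps)))
    (pi : ℕ → ℝ) (hpi0 : pi 0 = 1)
    (hrec : ∀ i, pi (i+1) = 1 - (1 - ρ * pi i) ^ ((1:ℝ)/d)) :
    SLQEquilibrium lam mu gam r d pi eps := by
  have hrmu : 0 < r * mu := mul_pos hr hmu
  have heps0 : 0 < eps := heps ▸ div_pos hlam hrmu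
  have heps1 : eps < 1 := heps ▸ hload
  have hlam_eq : lam = r * (mu * eps) := by
    rw [heps]
    field_simp
  have hgap : 0 < r * (gam * (1 - eps)) := mul_pos hr (mul_pos hgam (sub_pos.2 heps1))
  have hrate : lam < r * (gam * (1 - eps) + mu * eps) := by linarith
  have hrate0 : 0 < r * (gam * (1 - eps) + mu * eps) := hlam.trans hrate
  have hρ0 : 0 < ρ := hρ ▸ div_pos hlam hrate0
  have hρ1 : ρ < 1 := hρ ▸ (div_lt_one hrate0).2 hrate
  have hρ_mul : r * (gam * (1 - eps) + mu * eps) * ρ = lam := by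
    rw [hρ]
    exact mul_div_cancel₀ lam hrate0.ne'
  have hmem : ∀ i, pi i ∈ Set.Icc (0 : ℝ) 1 := by
    intro i
    induction i with
    | zero => simp [hpi0]
    | succ k ih =>
      have hlower : 0 ≤ 1 - ρ * pi k := by nlinarith [ih.1, ih.2]
      have hupper : 1 - ρ * pi k ≤ 1 := by nlinarith [ih.1]
      rw [hrec k]
      exact ⟨sub_nonneg.2 (Real.rpow_le_one hlower hupper (by positivity)),
        sub_le_self 1 (Real.rpow_nonneg hlower _)⟩
  have hpow : ∀ i, (1 - pi (i + 1)) ^ d = 1 - ρ * pi i := by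
    intro i
    have hlower : 0 ≤ 1 - ρ * pi i := by nlinarith [(hmem i).1, (hmem i).2]
    rw [hrec i, sub_sub_cancel, one_div, Real.rpow_inv_natCast_pow hlower hd.ne']
  refine ⟨hpi0, hmem, ⟨heps0.le, heps1.le⟩, ?_, ?_⟩
  · rintro (_ | k) hk
    · omega
    · rw [hpow, hpow, Nat.add_sub_cancel]
      linear_combination (pi (k + 1) - pi k) * hρ_mul
  · have hfirst := hpow 0
    rw [zero_add, hpi0, mul_one] at hfirst
    rw [hfirst]
    apply mul_left_cancel₀ hr.ne'
    linear_combination hρ_mul + hlam_eq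
end

section
/- Fix positive reals λ, μ, γ, r and a positive integer d with λ/(rμ) < 1. If (π, ε) and (π′, ε′) are both equilibrium states of the SLQ(d) mean-field equations with ∑_{i≥1} πᵢ < ∞ and ∑_{i≥1} π′ᵢ < ∞, then ε = ε′ and πᵢ = π′ᵢ for all i ≥ 0. -/
open Filter Topology in
/-- Telescoping the flow equations: the total arrival rate equals the total service rate. -/
theorem SLQEquilibrium.flow_balance {lam mu gam r : ℝ} {d : ℕ} {pi : ℕ → ℝ} {eps : ℝ}
    (h : SLQEquilibrium lam mu gam r d pi eps) (hsum : Summable (fun i => pi (i+1))) :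
    lam = r * (gam * (1 - eps) + mu * eps) * (1 - (1 - pi 1)^d) := by
  obtain ⟨h0, -, -, hflow, -⟩ := h
  have partial_sum (n : ℕ) : lam * (1 - pi n)
      = r * (gam * (1 - eps) + mu * eps) * ((1 - pi (n+1))^d - (1 - pi 1)^d) := by
    induction n with
    | zero => simp [h0]
    | succ n ih =>
      have := hflow (n+1) (by lia)
      rw [Nat.add_sub_cancel] at this
      linear_combination ih + this
  have lim₁ : Tendsto (fun n => pi (n+1)) atTop (𝓝 0) := hsum.tendsto_atTop_zero
  have lim₀ : Tendsto pi atTop (𝓝 0) := (tendsto_add_atTop_iff_nat 1).1 lim₁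
  have left : Tendsto (fun n => lam * (1 - pi n)) atTop (𝓝 (lam * (1 - 0))) :=
    (lim₀.const_sub 1).const_mul lam
  have right := (((lim₁.const_sub 1).pow d).sub_const ((1 - pi 1)^d)).const_mul
    (r * (gam * (1 - eps) + mu * eps))
  simp_rw [partial_sum] at left
  simpa using tendsto_nhds_unique left right

/-- The server equation turns flow balance into `lam = r * mu * eps`. -/
theorem SLQEquilibrium.lam_eq {lam mu gam r : ℝ} {d : ℕ} {pi : ℕ → ℝ} {eps : ℝ}
    (h : SLQEquilibrium lam mu gam r d pi eps) (hsum : Summable (fun i => pi (i+1))) :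
    lam = r * mu * eps := by
  linear_combination h.flow_balance hsum + r * h.2.2.2.2

theorem slq_equilibrium_unique
    (lam mu gam r : ℝ) (d : ℕ)
    (hlam : 0 < lam) (hmu : 0 < mu) (hgam : 0 < gam) (hr : 0 < r) (hd : 0 < d)
    (hload : lam / (r * mu) < 1)
    (pi pi' : ℕ → ℝ) (eps eps' : ℝ)
    (h : SLQEquilibrium lam mu gam r d pi eps)
    (h' : SLQEquilibrium lam mu gam r d pi' eps')
    (hsum : Summable (fun i => pi (i+1)))
    (hsum' : Summable (fun i => pi' (i+1))) :
    eps = eps' ∧ ∀ i, pi i = pi' i := by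
  have heps : eps = eps' := mul_left_cancel₀ (mul_pos hr hmu).ne'
    ((h.lam_eq hsum).symm.trans (h'.lam_eq hsum'))
  subst heps
  refine ⟨rfl, ?_⟩
  have bal := h.flow_balance hsum
  have bal' := h'.flow_balance hsum'
  obtain ⟨h0, hmem, -, hflow, -⟩ := h
  obtain ⟨h0', hmem', -, hflow', -⟩ := h'
  have hc : r * (gam * (1 - eps) + mu * eps) ≠ 0 := by
    intro hc
    rw [hc, zero_mul] at bal
    exact hlam.ne' bal
  have eq_of_pow (i : ℕ) (hi : (1 - pi i)^d = (1 - pi' i)^d) : pi i = pi' i := by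
    have := (pow_left_inj₀ (sub_nonneg.2 (hmem i).2) (sub_nonneg.2 (hmem' i).2) hd.ne').1 hi
    linarith
  have consecutive (i : ℕ) : pi i = pi' i ∧ pi (i+1) = pi' (i+1) := by
    induction i with
    | zero =>
      refine ⟨h0.trans h0'.symm, eq_of_pow 1 (mul_left_cancel₀ hc ?_)⟩
      linear_combination bal - bal'
    | succ n ih =>
      refine ⟨ih.2, eq_of_pow (n+2) (mul_left_cancel₀ hc ?_)⟩
      have e := hflow (n+1) (by lia)
      have e' := hflow' (n+1) (by lia)
      rw [Nat.add_sub_cancel, ih.1, ih.2] at e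
      rw [Nat.add_sub_cancel] at e'
      linear_combination e' - e
  exact fun i => (consecutive i).1
end

section
/- Fix positive reals λ, μ, γ, r with λ/(rμ) < 1, set ε = λ/(rμ) and ρ = λ/(r(γ(1−ε) + με)), and define πᵢ* = ρⁱ for i ≥ 0. Then (π*, ε) is an equilibrium state of the SLQ(1) mean-field equations (the case d = 1), and ∑_{i≥1} πᵢ* = ρ/(1 − ρ). -/
theorem slq_one_equilibrium_geometric
    (lam mu gam r : ℝ)
    (hlam : 0 < lam) (hmu : 0 < mu) (hgam : 0 < gam) (hr : 0 < r)
    (hload : lam / (r * mu) < 1)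
    (eps ρ : ℝ)
    (heps : eps = lam / (r * mu))
    (hρ : ρ = lam / (r * (gam * (1 - eps) + mu * eps))) :
    SLQEquilibrium lam mu gam r 1 (fun i => ρ ^ i) eps ∧
    Summable (fun i : ℕ => ρ ^ (i+1)) ∧
    (∑' i : ℕ, ρ ^ (i+1)) = ρ / (1 - ρ) := by
  have heps_pos : 0 < eps := by rw [heps]; positivity
  have heps_lt : eps < 1 := heps ▸ hload
  have hlam_eq : lam = r * (mu * eps) := by rw [heps]; field_simp
  have hidle : 0 < gam * (1 - eps) := mul_pos hgam (sub_pos.2 heps_lt)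
  have hbusy : 0 < mu * eps := mul_pos hmu heps_pos
  have hrate : 0 < gam * (1 - eps) + mu * eps := add_pos hidle hbusy
  have hρ_mul : (gam * (1 - eps) + mu * eps) * ρ = mu * eps := by
    rw [hρ, hlam_eq]; field_simp
  have hρ_nonneg : 0 ≤ ρ := by rw [hρ]; positivity
  have hρ_lt : ρ < 1 := by
    refine lt_of_mul_lt_mul_left ?_ hrate.le
    rw [hρ_mul]; linarith
  have hsum : HasSum (fun i : ℕ => ρ ^ (i + 1)) (ρ / (1 - ρ)) := by
    simpa only [pow_succ', div_eq_mul_inv] using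
      (hasSum_geometric_of_lt_one hρ_nonneg hρ_lt).mul_left ρ
  refine ⟨⟨pow_zero ρ, fun i => ⟨pow_nonneg hρ_nonneg i, pow_le_one₀ hρ_nonneg hρ_lt.le⟩,
    ⟨heps_pos.le, heps_lt.le⟩, ?_, ?_⟩, hsum.summable, hsum.tsum_eq⟩
  · intro i hi
    obtain ⟨k, rfl⟩ := Nat.exists_eq_add_of_le' hi
    simp only [Nat.add_sub_cancel, pow_one]
    rw [hlam_eq]
    linear_combination (-r * (ρ ^ k - ρ ^ (k + 1))) * hρ_mul
  · simp only [pow_one]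
    linear_combination hρ_mul
end

section
/- Fix positive reals λ, μ, r with σ := λ/(rμ) < 1 and an integer d ≥ 2. Define π₀ = 1 and πᵢ = σ^{(dⁱ − 1)/(d − 1)} for i ≥ 1. Then for every i ≥ 1, (λ/r)(π_{i−1}^d − πᵢ^d) = μ(πᵢ − π_{i+1}); that is, π is an equilibrium of the JSQ(d) mean-field equations. -/
/-- The exponents `(d ^ i - 1) / (d - 1)` satisfy the recursion of geometric sums. -/
theorem geom_exponent_succ {d : ℕ} (hd : 2 ≤ d) (i : ℕ) :
    (d ^ (i + 1) - 1) / (d - 1) = d * ((d ^ i - 1) / (d - 1)) + 1 := by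
  rw [← Nat.geomSum_eq hd, ← Nat.geomSum_eq hd, geom_sum_succ]

theorem jsq_equilibrium
    (lam mu r : ℝ)
    (hlam : 0 < lam) (hmu : 0 < mu) (hr : 0 < r)
    (σ : ℝ) (hσ : σ = lam / (r * mu)) (hload : σ < 1)
    (d : ℕ) (hd : 2 ≤ d)
    (pi : ℕ → ℝ) (hpi0 : pi 0 = 1)
    (hpi : ∀ i, 1 ≤ i → pi i = σ ^ ((d ^ i - 1) / (d - 1))) :
    ∀ i, 1 ≤ i →
      (lam / r) * (pi (i-1) ^ d - pi i ^ d) = mu * (pi i - pi (i+1)) := by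
  have hpi' : ∀ i, pi i = σ ^ ((d ^ i - 1) / (d - 1)) := by
    intro i
    rcases Nat.eq_zero_or_pos i with rfl | hi
    · simp [hpi0]
    · exact hpi i hi
  have hrec : ∀ i, pi (i + 1) = σ * pi i ^ d := by
    intro i
    rw [hpi' (i + 1), hpi' i, geom_exponent_succ hd, ← pow_mul, pow_succ', mul_comm d]
  have hrate : lam / r = mu * σ := by
    rw [hσ]
    field_simp
  intro i hi
  obtain ⟨j, rfl⟩ := Nat.exists_eq_add_of_le' hi
  rw [Nat.add_sub_cancel, hrec (j + 1), hrate, mul_assoc, mul_sub, ← hrec j]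
end
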